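/- Let p, q be strictly positive C² probability densities on ℝ^d such that p, q and their first and second partial derivatives decay faster than any polynomial at infinity, while log p, log q, |∇ log p|², |∇ log q|², and the second logarithmic derivatives grow at most polynomially. Then ∫ |∇ log p − ∇ log q|² q dx = ∫ (2 Δ log p + |∇ log p|²) q dx + ∫ |∇ log q|² q dx. -/

import Mathlib

open MeasureTheory Real RealInnerProductSpace Filter

noncomputable def diverg {d : ℕ} (g : EuclideanSpace ℝ (Fin d) → EuclideanSpace ℝ (Fin d))
    (x : EuclideanSpace ℝ (Fin d)) : ℝ :=
  ∑ i, fderiv ℝ g x (EuclideanSpace.single i 1) i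

noncomputable def laplacian {d : ℕ} (f : EuclideanSpace ℝ (Fin d) → ℝ)
    (x : EuclideanSpace ℝ (Fin d)) : ℝ :=
  diverg (gradient f) x

noncomputable def gaussPdf {d : ℕ} (θ x : EuclideanSpace ℝ (Fin d)) : ℝ :=
  (2 * Real.pi) ^ (-(d : ℝ) / 2) * Real.exp (-‖x - θ‖ ^ 2 / 2)

theorem exists_forall_abs_le_of_tendsto_cocompact {X : Type*} [TopologicalSpace X] {f : X → ℝ}
    (hf : Continuous f) (h : Tendsto f (cocompact X) (nhds 0)) : ∃ K, ∀ x, |f x| ≤ K := by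
  let F : ZeroAtInftyContinuousMap X ℝ := ⟨⟨f, hf⟩, h⟩
  obtain ⟨K, hK⟩ := isBounded_iff_forall_norm_le.1 F.isBounded_range
  exact ⟨K, fun x => hK (f x) ⟨x, rfl⟩⟩

theorem exists_one_add_norm_pow_mul_le {E : Type*} [NormedAddCommGroup E] {f : E → ℝ}
    (hf : Continuous f)
    (hdecay : ∀ m : ℕ, Tendsto (fun x => ‖x‖ ^ m * f x) (cocompact E) (nhds 0)) (N : ℕ) :
    ∃ K, ∀ x, (1 + ‖x‖) ^ N * |f x| ≤ K := by
  obtain ⟨K₀, h₀⟩ := exists_forall_abs_le_of_tendsto_cocompact (by fun_prop) (hdecay 0)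
  obtain ⟨K₁, h₁⟩ := exists_forall_abs_le_of_tendsto_cocompact (by fun_prop) (hdecay N)
  refine ⟨2 ^ (N - 1) * (K₀ + K₁), fun x => ?_⟩
  have h0 := h₀ x
  have h1 := h₁ x
  rw [abs_mul, abs_of_nonneg (by positivity)] at h0 h1
  calc (1 + ‖x‖) ^ N * |f x| ≤ 2 ^ (N - 1) * (1 ^ N + ‖x‖ ^ N) * |f x| := by
        gcongr
        exact add_pow_le zero_le_one (norm_nonneg x) N
    _ = 2 ^ (N - 1) * (‖x‖ ^ 0 * |f x| + ‖x‖ ^ N * |f x|) := by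
        rw [one_pow, pow_zero]; ring
    _ ≤ 2 ^ (N - 1) * (K₀ + K₁) := by gcongr

/-- A continuous function dominated by polynomial growth times a rapidly decaying function
is integrable. -/
theorem integrable_of_abs_le_rpow_mul_of_rapid_decay {E : Type*} [NormedAddCommGroup E]
    [NormedSpace ℝ E] [FiniteDimensional ℝ E] [MeasurableSpace E] [BorelSpace E]
    {μ : Measure E} [μ.IsAddHaarMeasure] {f g : E → ℝ} {C r : ℝ} (hf : Continuous f)
    (hdecay : ∀ m : ℕ, Tendsto (fun x => ‖x‖ ^ m * f x) (cocompact E) (nhds 0))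
    (hC : 0 ≤ C) (hg : Continuous g) (hle : ∀ x, |g x| ≤ C * (1 + ‖x‖) ^ r * f x) :
    Integrable g μ := by
  set s : ℝ := Module.finrank ℝ E + 1 with hs
  obtain ⟨N, hN⟩ := exists_nat_ge (r + s)
  obtain ⟨K, hK⟩ := exists_one_add_norm_pow_mul_le hf hdecay N
  refine ((integrable_one_add_norm (μ := μ) (E := E) (r := s) (by linarith)).const_mul
    (C * K)).mono' hg.aestronglyMeasurable (Eventually.of_forall fun x => ?_)
  have hx : (1 : ℝ) ≤ 1 + ‖x‖ := by linarith [norm_nonneg x]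
  have hpow : (1 + ‖x‖) ^ r ≤ (1 + ‖x‖) ^ (-s) * (1 + ‖x‖) ^ N := by
    rw [← Real.rpow_natCast, ← Real.rpow_add (by linarith)]
    exact Real.rpow_le_rpow_of_exponent_le hx (by linarith)
  calc ‖g x‖ ≤ C * (1 + ‖x‖) ^ r * f x := hle x
    _ ≤ C * (1 + ‖x‖) ^ r * |f x| := by gcongr; exact le_abs_self _
    _ ≤ C * ((1 + ‖x‖) ^ (-s) * (1 + ‖x‖) ^ N) * |f x| := by gcongr
    _ = C * (1 + ‖x‖) ^ (-s) * ((1 + ‖x‖) ^ N * |f x|) := by ring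
    _ ≤ C * (1 + ‖x‖) ^ (-s) * K := by gcongr; exact hK x
    _ = C * K * (1 + ‖x‖) ^ (-s) := by ring

theorem contDiff_gradient {F : Type*} [NormedAddCommGroup F] [InnerProductSpace ℝ F]
    [CompleteSpace F] {f : F → ℝ} {m n : WithTop ℕ∞} (hf : ContDiff ℝ n f) (hmn : m + 1 ≤ n) :
    ContDiff ℝ m (gradient f) :=
  (InnerProductSpace.toDual ℝ F).symm.contDiff.comp (hf.fderiv_right hmn)

theorem continuous_norm_fderiv {E F : Type*} [NormedAddCommGroup E] [NormedSpace ℝ E]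
    [NormedAddCommGroup F] [NormedSpace ℝ F] {f : E → F} (hf : ContDiff ℝ 1 f) :
    Continuous fun x => ‖fderiv ℝ f x‖ :=
  (hf.continuous_fderiv one_ne_zero).norm

theorem abs_coord_le {d : ℕ} (x : EuclideanSpace ℝ (Fin d)) (i : Fin d) : |x i| ≤ ‖x‖ :=
  PiLp.norm_apply_le x i

theorem norm_clm_single_le {d : ℕ} {G : Type*} [NormedAddCommGroup G] [NormedSpace ℝ G]
    (L : EuclideanSpace ℝ (Fin d) →L[ℝ] G) (i : Fin d) :
    ‖L (EuclideanSpace.single i 1)‖ ≤ ‖L‖ := by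
  simpa using L.le_opNorm (EuclideanSpace.single i 1)

theorem fderiv_coord {d : ℕ} {E : Type*} [NormedAddCommGroup E] [NormedSpace ℝ E]
    {g : E → EuclideanSpace ℝ (Fin d)} {x : E} (hg : DifferentiableAt ℝ g x) (i : Fin d) (v : E) :
    fderiv ℝ (fun y => g y i) x v = fderiv ℝ g x v i := by
  have h := ((EuclideanSpace.proj i : EuclideanSpace ℝ (Fin d) →L[ℝ] ℝ).hasFDerivAt.comp x
    hg.hasFDerivAt).fderiv
  exact congrArg (fun L => L v) h

theorem fderiv_apply_eq_inner_gradient_log_mul {F : Type*} [NormedAddCommGroup F]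
    [InnerProductSpace ℝ F] [CompleteSpace F] {q : F → ℝ} {x : F} (hq : DifferentiableAt ℝ q x)
    (hx : 0 < q x) (v : F) :
    fderiv ℝ q x v = inner ℝ (gradient (fun y => Real.log (q y)) x) v * q x := by
  rw [inner_gradient_left, (hq.hasFDerivAt.log hx.ne').fderiv]
  simp [field]

/-- The divergence theorem for a vector field against a weight `q`, written with the score
`∇ log q`. -/
theorem integral_inner_gradient_log_mul_eq_neg_integral_diverg_mul {d : ℕ}
    {u : EuclideanSpace ℝ (Fin d) → EuclideanSpace ℝ (Fin d)} {q : EuclideanSpace ℝ (Fin d) → ℝ}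
    (hu : Differentiable ℝ u) (hq : Differentiable ℝ q) (hqpos : ∀ x, 0 < q x)
    (huq : ∀ i, Integrable fun x => u x i * q x)
    (hu'q : ∀ i, Integrable fun x => fderiv ℝ u x (EuclideanSpace.single i 1) i * q x)
    (huq' : ∀ i, Integrable fun x => u x i * fderiv ℝ q x (EuclideanSpace.single i 1)) :
    Integrable (fun x => inner ℝ (u x) (gradient (fun y => Real.log (q y)) x) * q x) ∧
      Integrable (fun x => diverg u x * q x) ∧
      ∫ x, inner ℝ (u x) (gradient (fun y => Real.log (q y)) x) * q x =
        -∫ x, diverg u x * q x := by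
  have hinner : (fun x => inner ℝ (u x) (gradient (fun y => Real.log (q y)) x) * q x) =
      fun x => ∑ i, u x i * fderiv ℝ q x (EuclideanSpace.single i 1) := by
    funext x
    simp_rw [fderiv_apply_eq_inner_gradient_log_mul (hq x) (hqpos x)]
    generalize gradient (fun y => Real.log (q y)) x = g
    rw [PiLp.inner_apply, Finset.sum_mul]
    refine Finset.sum_congr rfl fun i _ => ?_
    rw [EuclideanSpace.inner_single_right]
    simp only [RCLike.inner_apply, conj_trivial]
    ring
  have hdiv : (fun x => diverg u x * q x) =
      fun x => ∑ i, fderiv ℝ u x (EuclideanSpace.single i 1) i * q x := by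
    funext x
    rw [diverg, Finset.sum_mul]
  rw [hinner, hdiv]
  refine ⟨integrable_finsetSum _ fun i _ => huq' i, integrable_finsetSum _ fun i _ => hu'q i, ?_⟩
  rw [integral_finsetSum _ fun i _ => huq' i, integral_finsetSum _ fun i _ => hu'q i,
    ← Finset.sum_neg_distrib]
  refine Finset.sum_congr rfl fun i _ => ?_
  have hcoord : Differentiable ℝ fun x => u x i := fun x =>
    (EuclideanSpace.proj i : EuclideanSpace ℝ (Fin d) →L[ℝ] ℝ).differentiableAt.comp x (hu x)
  have hderiv : (fun x => fderiv ℝ u x (EuclideanSpace.single i 1) i * q x) =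
      fun x => fderiv ℝ (fun y => u y i) x (EuclideanSpace.single i 1) * q x := by
    funext x
    rw [fderiv_coord (hu x)]
  have hint := hu'q i
  rw [hderiv] at hint ⊢
  exact integral_mul_fderiv_eq_neg_fderiv_mul_of_integrable hint (huq' i) (huq i)
    (fun x _ => hcoord x) (fun x _ => hq x)

theorem stmt_8 {d : ℕ} (p q : EuclideanSpace ℝ (Fin d) → ℝ)
    (hp : ContDiff ℝ 2 p) (hq : ContDiff ℝ 2 q)
    (hppos : ∀ x, 0 < p x) (hqpos : ∀ x, 0 < q x)
    (hpd : ∫ x, p x = 1) (hqd : ∫ x, q x = 1)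
    (hpdecay : ∀ m : ℕ, Tendsto
      (fun x : EuclideanSpace ℝ (Fin d) =>
        ‖x‖ ^ m * (p x + ‖fderiv ℝ p x‖ + ‖fderiv ℝ (fderiv ℝ p) x‖))
      (cocompact _) (nhds 0))
    (hqdecay : ∀ m : ℕ, Tendsto
      (fun x : EuclideanSpace ℝ (Fin d) =>
        ‖x‖ ^ m * (q x + ‖fderiv ℝ q x‖ + ‖fderiv ℝ (fderiv ℝ q) x‖))
      (cocompact _) (nhds 0))
    (hpgrowth : ∃ C r : ℝ, 0 < C ∧ 0 < r ∧ ∀ x,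
      |Real.log (p x)| + ‖gradient (fun y => Real.log (p y)) x‖ ^ 2 +
        ‖fderiv ℝ (gradient fun y => Real.log (p y)) x‖ ≤ C * (1 + ‖x‖) ^ r)
    (hqgrowth : ∃ C r : ℝ, 0 < C ∧ 0 < r ∧ ∀ x,
      |Real.log (q x)| + ‖gradient (fun y => Real.log (q y)) x‖ ^ 2 +
        ‖fderiv ℝ (gradient fun y => Real.log (q y)) x‖ ≤ C * (1 + ‖x‖) ^ r) :
    ∫ x, ‖gradient (fun y => Real.log (p y)) x -
        gradient (fun y => Real.log (q y)) x‖ ^ 2 * q x =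
      (∫ x, (2 * laplacian (fun y => Real.log (p y)) x +
          ‖gradient (fun y => Real.log (p y)) x‖ ^ 2) * q x) +
        ∫ x, ‖gradient (fun y => Real.log (q y)) x‖ ^ 2 * q x := by
  obtain ⟨C, r, hC, hr, hCr⟩ := hpgrowth
  obtain ⟨C', r', hC', -, hCr'⟩ := hqgrowth
  have hu : ContDiff ℝ 1 (gradient fun y => Real.log (p y)) :=
    contDiff_gradient (hp.log fun x => (hppos x).ne') (by norm_num)
  have hv : ContDiff ℝ 1 (gradient fun y => Real.log (q y)) :=
    contDiff_gradient (hq.log fun x => (hqpos x).ne') (by norm_num)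
  simp only [laplacian]
  set u := gradient fun y => Real.log (p y)
  set v := gradient fun y => Real.log (q y) with hv_def
  set w : EuclideanSpace ℝ (Fin d) → ℝ :=
    fun x => q x + ‖fderiv ℝ q x‖ + ‖fderiv ℝ (fderiv ℝ q) x‖
  have hq' : ContDiff ℝ 1 (fderiv ℝ q) := hq.fderiv_right (by norm_num)
  have hcu : Continuous u := hu.continuous
  have hcv : Continuous v := hv.continuous
  have hcu' : Continuous (fderiv ℝ u) := hu.continuous_fderiv (by norm_num)
  have hcq : Continuous q := hq.continuous
  have hcq' : Continuous (fderiv ℝ q) := hq'.continuous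
  have hcq'' : Continuous fun x => ‖fderiv ℝ (fderiv ℝ q) x‖ :=
    continuous_norm_fderiv hq'
  have hcw : Continuous w := (hcq.add hcq'.norm).add hcq''
  have hqw : ∀ x, |q x| ≤ w x := fun x => by
    rw [abs_of_pos (hqpos x)]
    linarith [norm_nonneg (fderiv ℝ q x), norm_nonneg (fderiv ℝ (fderiv ℝ q) x)]
  have hq'w : ∀ x, ‖fderiv ℝ q x‖ ≤ w x := fun x => by
    linarith [hqpos x, norm_nonneg (fderiv ℝ (fderiv ℝ q) x)]
  have integrable_mul {a b : EuclideanSpace ℝ (Fin d) → ℝ} {A s : ℝ} (hA : 0 < A)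
      (ha : Continuous a) (hb : Continuous b) (hale : ∀ x, |a x| ≤ A * (1 + ‖x‖) ^ s)
      (hble : ∀ x, |b x| ≤ w x) : Integrable fun x => a x * b x := by
    refine integrable_of_abs_le_rpow_mul_of_rapid_decay hcw hqdecay hA.le (ha.mul hb)
      (r := s) fun x => ?_
    rw [abs_mul]
    exact mul_le_mul (hale x) (hble x) (abs_nonneg _) (by positivity)
  have husq : ∀ x, |‖u x‖ ^ 2| ≤ C * (1 + ‖x‖) ^ r := fun x => by
    rw [abs_of_nonneg (by positivity)]
    linarith [hCr x, abs_nonneg (Real.log (p x)), norm_nonneg (fderiv ℝ u x)]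
  have hvsq : ∀ x, |‖v x‖ ^ 2| ≤ C' * (1 + ‖x‖) ^ r' := fun x => by
    rw [abs_of_nonneg (by positivity)]
    linarith [hCr' x, abs_nonneg (Real.log (q x)), norm_nonneg (fderiv ℝ v x)]
  have hu' : ∀ i x, |fderiv ℝ u x (EuclideanSpace.single i 1) i| ≤ C * (1 + ‖x‖) ^ r :=
    fun i x => by
      linarith [hCr x, abs_nonneg (Real.log (p x)), sq_nonneg ‖u x‖,
        abs_coord_le (fderiv ℝ u x (EuclideanSpace.single i 1)) i,
        norm_clm_single_le (fderiv ℝ u x) i]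
  have hucoord : ∀ i x, |u x i| ≤ (C + 1) * (1 + ‖x‖) ^ r := fun i x => by
    have hx : (1 : ℝ) ≤ 1 + ‖x‖ := by linarith [norm_nonneg x]
    have hone : 1 ≤ (1 + ‖x‖) ^ r := Real.one_le_rpow hx hr.le
    nlinarith [abs_coord_le (u x) i, sq_nonneg (‖u x‖ - 1), (le_abs_self _).trans (husq x)]
  obtain ⟨hcross, hdiv, hparts⟩ := integral_inner_gradient_log_mul_eq_neg_integral_diverg_mul
    (hu.differentiable (by norm_num)) (hq.differentiable (by norm_num)) hqpos
    (fun i => integrable_mul (by positivity) (by fun_prop) hcq (hucoord i) hqw)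
    (fun i => integrable_mul hC (by fun_prop) hcq (hu' i) hqw)
    (fun i => integrable_mul (by positivity) (by fun_prop) (by fun_prop) (hucoord i)
      fun x => (norm_clm_single_le _ i).trans (hq'w x))
  rw [← hv_def] at hcross hparts
  have huI : Integrable fun x => ‖u x‖ ^ 2 * q x :=
    integrable_mul hC (by fun_prop) hcq husq hqw
  have hvI : Integrable fun x => ‖v x‖ ^ 2 * q x :=
    integrable_mul hC' (by fun_prop) hcq hvsq hqw
  have hlhs : ∀ x, ‖u x - v x‖ ^ 2 * q x =
      ‖u x‖ ^ 2 * q x - 2 * (inner ℝ (u x) (v x) * q x) + ‖v x‖ ^ 2 * q x := fun x => by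
    rw [norm_sub_sq_real]; ring
  have hrhs : ∀ x, (2 * diverg u x + ‖u x‖ ^ 2) * q x =
      2 * (diverg u x * q x) + ‖u x‖ ^ 2 * q x := fun x => by ring
  simp_rw [hlhs, hrhs]
  rw [integral_add (by exact huI.sub (hcross.const_mul 2)) hvI,
    integral_sub huI (hcross.const_mul 2), integral_add (hdiv.const_mul 2) huI,
    integral_const_mul, integral_const_mul, hparts]
  ring
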